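/- arXiv:2509.00402 — 3 statements merged into one kernel-verified Lean document; each statement's English description precedes it below -/
import Mathlib

section
/- Let V be a finite set with n = |V|, let h_k, h_m : V → ℝ^d be two embedding maps, and let κ : ℝ^d × ℝ^d → ℝ be L-Lipschitz in each argument with L ≥ 0. If the average embedding divergence satisfies (1/n) Σ_{i∈V} ‖h_k(i) − h_m(i)‖ ≤ ε for some ε ≥ 0 (and n ≥ 1), then the reconstructed adjacency matrices satisfy ‖Ã_k − Ã_m‖_F ≤ 2 L n² ε. -/
/-- The `ℓ²` norm of a finite family of reals is at most its `ℓ¹` norm. -/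
theorem sqrt_sum_sq_le_sum_abs {ι : Type*} (s : Finset ι) (f : ι → ℝ) :
    Real.sqrt (∑ i ∈ s, f i ^ 2) ≤ ∑ i ∈ s, |f i| := by
  refine Real.sqrt_le_iff.mpr ⟨Finset.sum_nonneg fun i _ => abs_nonneg _, ?_⟩
  simpa only [sq_abs] using
    Finset.sum_sq_le_sq_sum_of_nonneg (s := s) (f := fun i => |f i|) fun i _ => abs_nonneg _

/-- If two clients' embeddings have average divergence at most `ε` and the kernel
is `L`-Lipschitz in each argument, then the Frobenius distance of the reconstructed adjacency
matrices is at most `2 L n² ε`. -/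
theorem frobenius_dist_of_avg_coherence {V : Type*} [Fintype V] (d : ℕ)
    (hk hm : V → EuclideanSpace ℝ (Fin d))
    (κ : EuclideanSpace ℝ (Fin d) → EuclideanSpace ℝ (Fin d) → ℝ)
    (L ε : ℝ) (hL : 0 ≤ L) (hε : 0 ≤ ε)
    (hn : 1 ≤ Fintype.card V)
    (hκ₁ : ∀ a a' b : EuclideanSpace ℝ (Fin d), |κ a b - κ a' b| ≤ L * ‖a - a'‖)
    (hκ₂ : ∀ a b b' : EuclideanSpace ℝ (Fin d), |κ a b - κ a b'| ≤ L * ‖b - b'‖)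
    (hcoh : (1 / (Fintype.card V : ℝ)) * ∑ i : V, ‖hk i - hm i‖ ≤ ε) :
    Real.sqrt (∑ i : V, ∑ j : V, (κ (hk i) (hk j) - κ (hm i) (hm j)) ^ 2)
      ≤ 2 * L * (Fintype.card V : ℝ) ^ 2 * ε := by
  have hpos : (0 : ℝ) < Fintype.card V := by exact_mod_cast hn
  have hsum : ∑ i : V, ‖hk i - hm i‖ ≤ Fintype.card V * ε := by
    rwa [one_div, inv_mul_le_iff₀ hpos] at hcoh
  have hentry (i j : V) : |κ (hk i) (hk j) - κ (hm i) (hm j)|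
      ≤ L * (‖hk i - hm i‖ + ‖hk j - hm j‖) := by
    rw [mul_add]
    exact (abs_sub_le _ (κ (hm i) (hk j)) _).trans (add_le_add (hκ₁ _ _ _) (hκ₂ _ _ _))
  calc Real.sqrt (∑ i : V, ∑ j : V, (κ (hk i) (hk j) - κ (hm i) (hm j)) ^ 2)
      ≤ ∑ i : V, ∑ j : V, |κ (hk i) (hk j) - κ (hm i) (hm j)| := by
        simpa only [Fintype.sum_prod_type] using sqrt_sum_sq_le_sum_abs Finset.univ
          fun p : V × V => κ (hk p.1) (hk p.2) - κ (hm p.1) (hm p.2)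
    _ ≤ ∑ i : V, ∑ j : V, L * (‖hk i - hm i‖ + ‖hk j - hm j‖) := by
        gcongr with i _ j _
        exact hentry i j
    _ = 2 * L * Fintype.card V * ∑ i : V, ‖hk i - hm i‖ := by
        simp only [← Finset.mul_sum, Finset.sum_add_distrib, Finset.sum_const, Finset.card_univ,
          nsmul_eq_mul]
        ring
    _ ≤ 2 * L * Fintype.card V * (Fintype.card V * ε) := by gcongr
    _ = 2 * L * (Fintype.card V : ℝ) ^ 2 * ε := by ring
end

section
/- Let V be a finite set with n = |V|, let h_k, h_m : V → ℝ^d be two embedding maps, and let κ : ℝ^d × ℝ^d → ℝ be L-Lipschitz in each argument with L ≥ 0. If ‖h_k(i) − h_m(i)‖ ≤ ε for every i ∈ V and some ε ≥ 0, then the reconstructed adjacency matrices satisfy ‖Ã_k − Ã_m‖_F ≤ 2 L n ε. -/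
/-- If two clients' embeddings satisfy the uniform coherence bound
`‖h_k(i) − h_m(i)‖ ≤ ε` for every node `i`, and the kernel is `L`-Lipschitz in each argument,
then the Frobenius distance of the reconstructed adjacency matrices is at most `2 L n ε`. -/
theorem frobenius_dist_of_uniform_coherence {V : Type*} [Fintype V] (d : ℕ)
    (hk hm : V → EuclideanSpace ℝ (Fin d))
    (κ : EuclideanSpace ℝ (Fin d) → EuclideanSpace ℝ (Fin d) → ℝ)
    (L ε : ℝ) (hL : 0 ≤ L) (hε : 0 ≤ ε)
    (hκ₁ : ∀ a a' b : EuclideanSpace ℝ (Fin d), |κ a b - κ a' b| ≤ L * ‖a - a'‖)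
    (hκ₂ : ∀ a b b' : EuclideanSpace ℝ (Fin d), |κ a b - κ a b'| ≤ L * ‖b - b'‖)
    (hcoh : ∀ i : V, ‖hk i - hm i‖ ≤ ε) :
    Real.sqrt (∑ i : V, ∑ j : V, (κ (hk i) (hk j) - κ (hm i) (hm j)) ^ 2)
      ≤ 2 * L * (Fintype.card V : ℝ) * ε := by
  have entry (i j : V) : |κ (hk i) (hk j) - κ (hm i) (hm j)| ≤ 2 * L * ε :=
    calc |κ (hk i) (hk j) - κ (hm i) (hm j)|
        ≤ |κ (hk i) (hk j) - κ (hm i) (hk j)| + |κ (hm i) (hk j) - κ (hm i) (hm j)| :=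
          abs_sub_le _ _ _
      _ ≤ L * ‖hk i - hm i‖ + L * ‖hk j - hm j‖ := add_le_add (hκ₁ _ _ _) (hκ₂ _ _ _)
      _ ≤ L * ε + L * ε := by gcongr <;> exact hcoh _
      _ = 2 * L * ε := by ring
  refine Real.sqrt_le_iff.mpr ⟨by positivity, ?_⟩
  calc ∑ i : V, ∑ j : V, (κ (hk i) (hk j) - κ (hm i) (hm j)) ^ 2
      ≤ ∑ _i : V, ∑ _j : V, (2 * L * ε) ^ 2 :=
        Finset.sum_le_sum fun i _ => Finset.sum_le_sum fun j _ =>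
          sq_le_sq.mpr ((entry i j).trans (le_abs_self _))
    _ = (2 * L * (Fintype.card V : ℝ) * ε) ^ 2 := by
        simp only [Finset.sum_const, Finset.card_univ, nsmul_eq_mul]
        ring
end

section
/- (Cluster Preservation, explicit-constant form.) Let V be a finite set with n = |V| ≥ 1, let h_k, h_m, h_n : V → ℝ^d be the embedding maps of clients k, m, n, and let κ : ℝ^d × ℝ^d → ℝ be L-Lipschitz in each argument with L ≥ 0. Suppose the same-cluster coherence (1/n) Σ_{i∈V} ‖h_k(i) − h_m(i)‖ ≤ ε_C holds for some ε_C ≥ 0, and the cross-cluster separation ‖Ã_k − Ã_n‖_F ≥ ξ · 2 L n² ε_C holds for some ξ > 0. Then ‖Ã_k − Ã_m‖_F ≤ (1/ξ) · ‖Ã_k − Ã_n‖_F, i.e., the same-cluster reconstructions remain closer (by factor 1/ξ) than the cross-cluster reconstructions. -/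
/-- The Frobenius norm of a real matrix is at most its entrywise `ℓ¹` norm. -/
theorem sqrt_sum_sum_sq_le_sum_sum_abs {ι : Type*} [Fintype ι] (f : ι → ι → ℝ) :
    Real.sqrt (∑ i, ∑ j, f i j ^ 2) ≤ ∑ i, ∑ j, |f i j| := by
  refine Real.sqrt_le_iff.2 ⟨by positivity, ?_⟩
  simp only [← Fintype.sum_prod_type', ← sq_abs (f _ _)]
  exact Finset.sum_sq_le_sq_sum_of_nonneg fun _ _ => abs_nonneg _

/-- For a kernel that is `L`-Lipschitz in each argument, the reconstructed adjacency matrices of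
two embeddings differ in Frobenius norm by at most `2 L n` times their total displacement. -/
theorem sqrt_sum_sum_sq_kernel_sub_le {V E : Type*} [Fintype V] [SeminormedAddCommGroup E]
    (h h' : V → E) (κ : E → E → ℝ) (L : ℝ)
    (hκ₁ : ∀ a a' b : E, |κ a b - κ a' b| ≤ L * ‖a - a'‖)
    (hκ₂ : ∀ a b b' : E, |κ a b - κ a b'| ≤ L * ‖b - b'‖) :
    Real.sqrt (∑ i, ∑ j, (κ (h i) (h j) - κ (h' i) (h' j)) ^ 2)
      ≤ 2 * L * Fintype.card V * ∑ i, ‖h i - h' i‖ := by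
  calc Real.sqrt (∑ i, ∑ j, (κ (h i) (h j) - κ (h' i) (h' j)) ^ 2)
      ≤ ∑ i, ∑ j, |κ (h i) (h j) - κ (h' i) (h' j)| := sqrt_sum_sum_sq_le_sum_sum_abs _
    _ ≤ ∑ i, ∑ j, (L * ‖h i - h' i‖ + L * ‖h j - h' j‖) := by
        gcongr with i _ j _
        exact (abs_sub_le _ (κ (h' i) (h j)) _).trans (add_le_add (hκ₁ _ _ _) (hκ₂ _ _ _))
    _ = 2 * L * Fintype.card V * ∑ i, ‖h i - h' i‖ := by
        simp only [Finset.sum_add_distrib, Finset.sum_const, Finset.card_univ, nsmul_eq_mul,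
          ← Finset.mul_sum]
        ring

/-- Cluster Preservation, explicit-constant form: under same-cluster coherence
between clients `k` and `m`, and cross-cluster separation
`‖Ã_k − Ã_n‖_F ≥ ξ · 2 L n² ε_C` from client `n`, the same-cluster reconstructions satisfy
`‖Ã_k − Ã_m‖_F ≤ (1/ξ) ‖Ã_k − Ã_n‖_F`. -/
theorem cluster_preservation {V : Type*} [Fintype V] (d : ℕ)
    (hk hm hn : V → EuclideanSpace ℝ (Fin d))
    (κ : EuclideanSpace ℝ (Fin d) → EuclideanSpace ℝ (Fin d) → ℝ)
    (L εC ξ : ℝ) (hL : 0 ≤ L) (hε : 0 ≤ εC) (hξ : 0 < ξ)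
    (hcard : 1 ≤ Fintype.card V)
    (hκ₁ : ∀ a a' b : EuclideanSpace ℝ (Fin d), |κ a b - κ a' b| ≤ L * ‖a - a'‖)
    (hκ₂ : ∀ a b b' : EuclideanSpace ℝ (Fin d), |κ a b - κ a b'| ≤ L * ‖b - b'‖)
    (hcoh : (1 / (Fintype.card V : ℝ)) * ∑ i : V, ‖hk i - hm i‖ ≤ εC)
    (hsep : ξ * (2 * L * (Fintype.card V : ℝ) ^ 2 * εC)
      ≤ Real.sqrt (∑ i : V, ∑ j : V, (κ (hk i) (hk j) - κ (hn i) (hn j)) ^ 2)) :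
    Real.sqrt (∑ i : V, ∑ j : V, (κ (hk i) (hk j) - κ (hm i) (hm j)) ^ 2)
      ≤ (1 / ξ) * Real.sqrt (∑ i : V, ∑ j : V, (κ (hk i) (hk j) - κ (hn i) (hn j)) ^ 2) := by
  have hcard_pos : (0 : ℝ) < Fintype.card V := by exact_mod_cast hcard
  have hsum : ∑ i, ‖hk i - hm i‖ ≤ Fintype.card V * εC := by
    rwa [one_div, inv_mul_le_iff₀ hcard_pos] at hcoh
  rw [one_div, le_inv_mul_iff₀ hξ]
  refine le_trans ?_ hsep
  gcongr
  calc _ ≤ 2 * L * Fintype.card V * ∑ i, ‖hk i - hm i‖ :=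
        sqrt_sum_sum_sq_kernel_sub_le hk hm κ L hκ₁ hκ₂
    _ ≤ 2 * L * Fintype.card V * (Fintype.card V * εC) := by gcongr
    _ = 2 * L * (Fintype.card V : ℝ) ^ 2 * εC := by ring
end
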